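/- arXiv:2310.11214 — 3 statements merged into one kernel-verified Lean document; each statement's English description precedes it below -/
import Mathlib

section
/- Let x ∈ ℂ^d \ {0}, let (V,E) be an undirected graph on V = {1,…,d} with no self-loops, with vertex weights α_i = |x_i|², Laplacian ℒ, spectral gap λ₂ > 0, and B = Σ_{k,ℓ} |ℒ_{k,ℓ}|. Let ε > 0 satisfy ε ≤ min{|x|²/d², |x|²λ₂/(12B)}, and let Y ∈ ℂ^{d×d} be positive semidefinite with |Y_{k,ℓ} − x_k conj(x_ℓ)| ≤ ε for all (k,ℓ) ∈ D ∪ E (D the diagonal). Then ‖Y − x⊗conj(x)‖_F ≤ √(3|x|²B/λ₂) · √ε. -/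
open Finset Matrix
open scoped ComplexOrder

/-- The Laplacian of a vertex-weighted graph `(V,E,α)`:
`L(u,u) = Σ_{z∼u} α_z`, `L(u,v) = −√(α_u α_v)` for `u∼v`, and `0` otherwise. -/
noncomputable def weightedLaplacian {d : ℕ} (G : SimpleGraph (Fin d))
    [DecidableRel G.Adj] (α : Fin d → ℝ) : Matrix (Fin d) (Fin d) ℝ :=
  fun u v =>
    if u = v then ∑ z ∈ G.neighborFinset u, α z
    else if G.Adj u v then -Real.sqrt (α u * α v) else 0

lemma psd_real_form {d : ℕ} {Y : Matrix (Fin d) (Fin d) ℂ} (hY : Y.PosSemidef) (v : Fin d → ℂ) :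
    0 ≤ ∑ k, ∑ l, ((starRingEnd ℂ) (v k) * Y k l * v l).re := by
  have h := (Complex.le_def.mp (hY.dotProduct_mulVec_nonneg v)).1
  simp only [dotProduct, mulVec, Finset.mul_sum, Complex.re_sum, Complex.zero_re] at h
  simpa [mul_assoc] using h

lemma psd_minor {d : ℕ} {Y : Matrix (Fin d) (Fin d) ℂ} (hY : Y.PosSemidef) (k l : Fin d) :
    ‖Y k l‖ ^ 2 ≤ (Y k k).re * (Y l l).re := by
  have h := (hY.submatrix ![k, l]).det_nonneg
  rw [det_fin_two] at h
  have h1 : Y l k = (starRingEnd ℂ) (Y k l) := (hY.1.apply l k).symm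
  have hk := congrArg Complex.im (hY.1.apply k k)
  have hl := congrArg Complex.im (hY.1.apply l l)
  have h2 := (Complex.le_def.mp h).1
  simp [h1] at h2 hk hl
  rw [← Complex.normSq_eq_norm_sq, Complex.normSq_apply]
  have hk' : (Y k k).im = 0 := by linarith
  rw [hk'] at h2
  linarith

lemma spec_core {d : ℕ} (A : Matrix (Fin d) (Fin d) ℝ) (hA : A.IsHermitian) (i0 : Fin d)
    (m : ℝ) (hm : 0 < m) (hl : ∀ i, i ≠ i0 → m ≤ hA.eigenvalues i)
    (r : Fin d → ℝ) (hr : r ≠ 0) (hAr : ∀ k, ∑ l, A k l * r l = 0)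
    (Z : Fin d → Fin d → ℝ) (hZ : ∀ v : Fin d → ℝ, 0 ≤ ∑ k, ∑ l, v k * v l * Z k l) :
    hA.eigenvalues i0 = 0 ∧
    m * ((∑ k, r k ^ 2) * ∑ k, Z k k - ∑ k, ∑ l, r k * r l * Z k l) ≤
      (∑ k, r k ^ 2) * ∑ k, ∑ l, A k l * Z k l := by
  set ev := hA.eigenvalues with hev
  obtain ⟨u, h1, h2, h3⟩ : ∃ u : Fin d → Fin d → ℝ,
      (∀ i k, ∑ l, A k l * u i l = ev i * u i k) ∧
      (∀ k l, ∑ i, u i k * u i l = if k = l then 1 else 0) ∧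
      (∀ i j, ∑ k, u i k * u j k = if i = j then 1 else 0) := by
    refine ⟨fun i k => hA.eigenvectorBasis i k, ?_, ?_, ?_⟩
    · intro i k
      have := congrFun (hA.mulVec_eigenvectorBasis i) k
      simpa [mulVec, dotProduct] using this
    · intro k l
      have := hA.eigenvectorBasis.sum_inner_mul_inner (EuclideanSpace.single k 1)
        (EuclideanSpace.single l 1)
      simpa [EuclideanSpace.inner_single_left, EuclideanSpace.inner_single_right,
        PiLp.single_apply, eq_comm] using this
    · intro i j
      have := orthonormal_iff_ite.mp hA.eigenvectorBasis.orthonormal i j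
      simpa [PiLp.inner_apply, mul_comm] using this
  have hAd : ∀ k l, A k l = ∑ i, ev i * (u i k * u i l) := by
    intro k l
    calc A k l = ∑ z, A k z * (if z = l then 1 else 0) := by simp
      _ = ∑ z, ∑ i, A k z * u i z * u i l := by
          refine sum_congr rfl fun z _ => ?_
          rw [← h2, mul_sum]; exact sum_congr rfl fun i _ => by ring
      _ = _ := by
          rw [sum_comm]
          refine sum_congr rfl fun i _ => ?_
          rw [← sum_mul, h1]; ring
  set c : Fin d → ℝ := fun i => ∑ k, u i k * r k with hc
  have hrc : ∀ k, r k = ∑ i, c i * u i k := by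
    intro k
    calc r k = ∑ l, (if k = l then 1 else 0) * r l := by simp
      _ = ∑ l, ∑ i, u i l * r l * u i k := by
          refine sum_congr rfl fun z _ => ?_
          rw [← h2, sum_mul]; exact sum_congr rfl fun i _ => by ring
      _ = _ := by
          rw [sum_comm]
          exact sum_congr rfl fun i _ => by rw [hc, ← sum_mul]
  have hsym : ∀ k l, A k l = A l k := fun k l => by
    rw [hAd, hAd]; exact sum_congr rfl fun i _ => by ring
  have hlc : ∀ i, ev i * c i = 0 := by
    intro i
    calc ev i * c i = ∑ k, (∑ l, A k l * u i l) * r k := by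
          rw [hc, mul_sum]; exact sum_congr rfl fun k _ => by rw [h1]; ring
      _ = ∑ l, u i l * ∑ k, A l k * r k := by
          simp only [sum_mul, mul_sum]
          rw [sum_comm]
          exact sum_congr rfl fun l _ => sum_congr rfl fun k _ => by rw [hsym k l]; ring
      _ = 0 := by simp [hAr]
  have hc0 : ∀ i, i ≠ i0 → c i = 0 := fun i hi => by
    have := hl i hi
    rcases mul_eq_zero.mp (hlc i) with h | h
    · linarith
    · exact h
  have hrc' : ∀ k, r k = c i0 * u i0 k := by
    intro k
    rw [hrc k]
    exact sum_eq_single i0 (fun i _ hi => by rw [hc0 i hi, zero_mul]) (by simp)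
  have hcne : c i0 ≠ 0 := by
    intro h
    exact hr (funext fun k => by rw [hrc' k, h, zero_mul]; rfl)
  have he0 : ev i0 = 0 := (mul_eq_zero.mp (hlc i0)).resolve_right hcne
  refine ⟨he0, ?_⟩
  set w : Fin d → ℝ := fun i => ∑ k, ∑ l, u i k * u i l * Z k l with hw
  have hwn : ∀ i, 0 ≤ w i := fun i => hZ (u i)
  have hr2 : ∑ k, r k ^ 2 = c i0 ^ 2 := by
    calc _ = c i0 ^ 2 * ∑ k, u i0 k * u i0 k := by
          rw [mul_sum]; exact sum_congr rfl fun k _ => by rw [hrc' k]; ring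
      _ = _ := by rw [h3]; simp
  have hrZ : ∑ k, ∑ l, r k * r l * Z k l = c i0 ^ 2 * w i0 := by
    simp only [hw, mul_sum]
    exact sum_congr rfl fun k _ => sum_congr rfl fun l _ => by rw [hrc' k, hrc' l]; ring
  have htr : ∑ k, Z k k = ∑ i, w i := by
    calc ∑ k, Z k k = ∑ k, ∑ l, (∑ i, u i k * u i l) * Z k l := by simp [h2]
      _ = _ := by
        simp only [hw, sum_mul]
        conv_rhs => rw [sum_comm]
        refine sum_congr rfl fun k _ => ?_
        rw [sum_comm]
  have hAZ : ∑ k, ∑ l, A k l * Z k l = ∑ i, ev i * w i := by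
    calc _ = ∑ k, ∑ l, ∑ i, ev i * (u i k * u i l * Z k l) := by
          refine sum_congr rfl fun k _ => sum_congr rfl fun l _ => ?_
          rw [hAd, sum_mul]; exact sum_congr rfl fun i _ => by ring
      _ = _ := by
        simp only [hw, mul_sum]
        conv_rhs => rw [sum_comm]
        refine sum_congr rfl fun k _ => ?_
        rw [sum_comm]
  rw [hr2, hrZ, htr, hAZ]
  have key : m * (∑ i, w i - w i0) ≤ ∑ i, ev i * w i := by
    rw [← add_sum_erase univ w (mem_univ i0), ← add_sum_erase univ (fun i => ev i * w i) (mem_univ i0)]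
    simp only [he0, zero_mul, zero_add, add_sub_cancel_left, mul_sum]
    exact sum_le_sum fun i hi => mul_le_mul_of_nonneg_right (hl i (ne_of_mem_erase hi)) (hwn i)
  calc _ = c i0 ^ 2 * (m * (∑ i, w i - w i0)) := by ring
    _ ≤ _ := mul_le_mul_of_nonneg_left key (sq_nonneg _)

lemma lap_mul {d : ℕ} (G : SimpleGraph (Fin d)) [DecidableRel G.Adj] (r : Fin d → ℝ)
    (hr : ∀ i, 0 ≤ r i) (k : Fin d) :
    ∑ l, weightedLaplacian G (fun i => r i ^ 2) k l * r l = 0 := by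
  rw [← add_sum_erase univ _ (mem_univ k)]
  have h : ∀ l ∈ univ.erase k, weightedLaplacian G (fun i => r i ^ 2) k l * r l =
      -(if G.Adj k l then r k * r l ^ 2 else 0) := by
    intro l hl
    have hkl : k ≠ l := (ne_of_mem_erase hl).symm
    have hs : Real.sqrt (r k ^ 2 * r l ^ 2) = r k * r l := by
      rw [← mul_pow]; exact Real.sqrt_sq (mul_nonneg (hr k) (hr l))
    unfold weightedLaplacian
    rw [if_neg hkl, hs]
    split_ifs <;> ring
  rw [sum_congr rfl h, sum_neg_distrib]
  have h2 : ∑ l ∈ univ.erase k, (if G.Adj k l then r k * r l ^ 2 else 0) =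
      ∑ l, (if G.Adj k l then r k * r l ^ 2 else 0) := by
    rw [← add_sum_erase univ _ (mem_univ k)]; simp
  rw [h2]
  unfold weightedLaplacian
  rw [if_pos rfl, SimpleGraph.neighborFinset_eq_filter, sum_filter, sum_mul,
    ← sub_eq_add_neg, ← sum_sub_distrib]
  refine sum_eq_zero fun l _ => ?_
  split_ifs <;> ring

/-- Rank-one matrix completion (Frobenius error bound, Demanet–Jugnon type):
let `x ∈ ℂ^d \ {0}`, let `(V,E)` be a graph on `{1,…,d}` with vertex weights
`α_i = |x_i|²`, Laplacian `ℒ`, spectral gap `λ₂ = e 1 > 0` (where `e` lists the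
eigenvalues of `ℒ` in nondecreasing order), and `B = Σ_{k,ℓ}|ℒ_{k,ℓ}|`. If
`ε ≤ min{|x|²/d², |x|²λ₂/(12B)}` and `Y ⪰ 0` satisfies
`|Y_{k,ℓ} − x_k conj(x_ℓ)| ≤ ε` on the diagonal and on the edges, then
`‖Y − x⊗conj(x)‖_F ≤ √(3|x|²B/λ₂) · √ε`. -/
theorem rank_one_completion_frobenius {d : ℕ} (hd : 1 < d)
    (x : Fin d → ℂ) (hx : x ≠ 0)
    (G : SimpleGraph (Fin d)) [DecidableRel G.Adj]
    (hH : (weightedLaplacian G (fun i => ‖x i‖ ^ 2)).IsHermitian)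
    (e : Fin d → ℝ) (hmono : Monotone e)
    (hperm : ∃ σ : Equiv.Perm (Fin d), e = hH.eigenvalues ∘ σ)
    (hgap : 0 < e ⟨1, hd⟩)
    (B : ℝ) (hB : B = ∑ k, ∑ l, |weightedLaplacian G (fun i => ‖x i‖ ^ 2) k l|)
    (ε : ℝ) (hεpos : 0 < ε)
    (hε : ε ≤ min ((∑ i, ‖x i‖ ^ 2) / (d : ℝ) ^ 2)
      ((∑ i, ‖x i‖ ^ 2) * e ⟨1, hd⟩ / (12 * B)))
    (Y : Matrix (Fin d) (Fin d) ℂ) (hY : Y.PosSemidef)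
    (hclose : ∀ k l, (k = l ∨ G.Adj k l) →
      ‖Y k l - x k * (starRingEnd ℂ) (x l)‖ ≤ ε) :
    Real.sqrt (∑ k, ∑ l, ‖Y k l - x k * (starRingEnd ℂ) (x l)‖ ^ 2) ≤
      Real.sqrt (3 * (∑ i, ‖x i‖ ^ 2) * B / e ⟨1, hd⟩) * Real.sqrt ε := by
  have hphase : ∀ i, ∃ s : ℂ, ‖s‖ = 1 ∧ x i = ‖x i‖ * s := by
    intro i
    by_cases h : x i = 0
    · exact ⟨1, by simp, by simp [h]⟩
    · have hn : ‖x i‖ ≠ 0 := by simpa using h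
      refine ⟨x i / ‖x i‖, by simp [hn], ?_⟩
      have : (‖x i‖ : ℂ) ≠ 0 := by exact_mod_cast hn
      field_simp
  choose s hs1 hs2 using hphase
  obtain ⟨σ, hσ⟩ := hperm
  set A := weightedLaplacian G (fun i => ‖x i‖ ^ 2) with hAdef
  set m := e ⟨1, hd⟩ with hm
  set N := ∑ i, ‖x i‖ ^ 2 with hN
  have hev : ∀ i, hH.eigenvalues i = e (σ.symm i) := fun i => by simp [hσ]
  have hl : ∀ i, i ≠ σ ⟨0, by omega⟩ → m ≤ hH.eigenvalues i := by
    intro i hi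
    rw [hev]
    apply hmono
    have : σ.symm i ≠ ⟨0, by omega⟩ := fun h => hi (by rw [← h]; simp)
    rw [Fin.le_def]
    have h2 : (σ.symm i).val ≠ 0 := fun h => this (Fin.ext h)
    show 1 ≤ (σ.symm i).val
    omega
  have hr0 : (fun i => ‖x i‖) ≠ 0 := fun h => hx (funext fun i => by
    simpa using congrFun h i)
  have hNpos : 0 < N := by
    obtain ⟨i, hi⟩ := Function.ne_iff.mp hx
    exact sum_pos' (fun i _ => by positivity) ⟨i, mem_univ _, by
      have : 0 < ‖x i‖ := norm_pos_iff.mpr hi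
      positivity⟩
  have hconj : ∀ i, (starRingEnd ℂ) (s i) * s i = 1 := fun i => by
    rw [mul_comm, Complex.mul_conj, Complex.normSq_eq_norm_sq, hs1]; simp
  have hLr := lap_mul G (fun i => ‖x i‖) (fun i => norm_nonneg _)
  obtain ⟨he0, hcore⟩ := spec_core A hH (σ ⟨0, by omega⟩) m hgap hl (fun i => ‖x i‖) hr0 hLr
    (fun k l => ((starRingEnd ℂ) (s k) * Y k l * s l).re) (by
      intro v
      refine (psd_real_form hY (fun k => v k * s k)).trans_eq ?_
      refine sum_congr rfl fun k _ => sum_congr rfl fun l _ => ?_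
      rw [← Complex.re_ofReal_mul]
      congr 1
      simp
      ring)
  -- simplification of the pieces
  have hdiag : ∀ k, ((starRingEnd ℂ) (s k) * Y k k * s k).re = (Y k k).re := fun k => by
    rw [mul_right_comm, hconj, one_mul]
  simp only [hdiag] at hcore
  set T := ∑ k, (Y k k).re with hT
  set q := ∑ k, ∑ l, ((starRingEnd ℂ) (x k) * Y k l * x l).re with hq
  have hq' : ∑ k, ∑ l, ‖x k‖ * ‖x l‖ * ((starRingEnd ℂ) (s k) * Y k l * s l).re = q := by
    refine sum_congr rfl fun k _ => sum_congr rfl fun l _ => ?_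
    rw [← Complex.re_ofReal_mul]
    congr 1
    conv_rhs => rw [hs2 k, hs2 l]
    simp only [map_mul, Complex.conj_ofReal, Complex.ofReal_mul]
    ring
  rw [hq'] at hcore
  have hAY : ∑ k, ∑ l, A k l * ((starRingEnd ℂ) (s k) * Y k l * s l).re ≤ B * ε := by
    have h0 : ∑ k, ∑ l, A k l * (‖x k‖ * ‖x l‖) = 0 := by
      refine sum_eq_zero fun k _ => ?_
      calc _ = ‖x k‖ * ∑ l, A k l * ‖x l‖ := by
            rw [mul_sum]; exact sum_congr rfl fun l _ => by ring
        _ = 0 := by rw [hLr k, mul_zero]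
    rw [← sub_zero (∑ k, ∑ l, A k l * ((starRingEnd ℂ) (s k) * Y k l * s l).re), ← h0,
      ← sum_sub_distrib, hB, sum_mul]
    refine sum_le_sum fun k _ => ?_
    rw [← sum_sub_distrib, sum_mul]
    refine sum_le_sum fun l _ => ?_
    by_cases hkl : k = l ∨ G.Adj k l
    · have hcl := hclose k l hkl
      have hid : ((starRingEnd ℂ) (s k) * Y k l * s l).re - ‖x k‖ * ‖x l‖ =
          ((starRingEnd ℂ) (s k) * (Y k l - x k * (starRingEnd ℂ) (x l)) * s l).re := by
        have : (starRingEnd ℂ) (s k) * (x k * (starRingEnd ℂ) (x l)) * s l =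
            ((‖x k‖ * ‖x l‖ : ℝ) : ℂ) := by
          conv_lhs => rw [hs2 k, hs2 l]
          simp only [map_mul, Complex.conj_ofReal, Complex.ofReal_mul]
          linear_combination (‖x k‖ : ℂ) * ‖x l‖ * ((starRingEnd ℂ) (s l) * s l) * hconj k +
            (‖x k‖ : ℂ) * ‖x l‖ * hconj l
        rw [mul_sub, sub_mul, this, Complex.sub_re, Complex.ofReal_re]
      rw [← mul_sub, hid]
      refine (le_abs_self _).trans ?_
      rw [abs_mul]
      refine mul_le_mul_of_nonneg_left ?_ (abs_nonneg _)
      refine (Complex.abs_re_le_norm _).trans ?_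
      rw [norm_mul, norm_mul, hs1 l, RCLike.norm_conj, hs1 k, one_mul, mul_one]
      exact hcl
    · push Not at hkl
      have : A k l = 0 := by
        rw [hAdef]; unfold weightedLaplacian
        rw [if_neg hkl.1, if_neg hkl.2]
      simp [this]
  have hBm : m ≤ B := by
    have htr := hH.trace_eq_sum_eigenvalues
    have h1 : m ≤ A.trace := by
      rw [htr]
      have hnn : ∀ i ∈ univ, 0 ≤ hH.eigenvalues i := fun i _ => by
        by_cases hi : i = σ ⟨0, by omega⟩
        · rw [hi, he0]
        · exact hgap.le.trans (hl i hi)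
      refine le_trans ?_ (single_le_sum hnn (mem_univ (σ ⟨1, hd⟩)))
      rw [hev]; simp [hm]
    refine h1.trans ?_
    rw [hB, trace]
    refine sum_le_sum fun k _ => ?_
    exact (le_abs_self _).trans
      (single_le_sum (f := fun l => |A k l|) (fun l _ => abs_nonneg _) (mem_univ k))
  have hTN : |T - N| ≤ d * ε := by
    rw [hT, hN, ← sum_sub_distrib]
    refine (abs_sum_le_sum_abs _ _).trans ?_
    have : ∀ k ∈ (univ : Finset (Fin d)), |(Y k k).re - ‖x k‖ ^ 2| ≤ ε := fun k _ => by
      have h := (Complex.abs_re_le_norm _).trans (hclose k k (Or.inl rfl))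
      rwa [Complex.mul_conj, Complex.sub_re, Complex.ofReal_re, Complex.normSq_eq_norm_sq] at h
    refine (sum_le_sum this).trans ?_
    simp
  have hF : ∑ k, ∑ l, ‖Y k l - x k * (starRingEnd ℂ) (x l)‖ ^ 2 ≤ T ^ 2 - 2 * q + N ^ 2 := by
    have h1 : T ^ 2 = ∑ k, ∑ l, (Y k k).re * (Y l l).re := by
      rw [sq, hT, sum_mul_sum]
    have h2 : N ^ 2 = ∑ k, ∑ l, ‖x k‖ ^ 2 * ‖x l‖ ^ 2 := by
      rw [sq, hN, sum_mul_sum]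
    rw [h1, h2, hq, mul_sum, ← sum_sub_distrib, ← sum_add_distrib]
    refine sum_le_sum fun k _ => ?_
    rw [mul_sum, ← sum_sub_distrib, ← sum_add_distrib]
    refine sum_le_sum fun l _ => ?_
    have h3 := psd_minor hY k l
    have h4 : ‖Y k l - x k * (starRingEnd ℂ) (x l)‖ ^ 2 =
        ‖Y k l‖ ^ 2 - 2 * ((starRingEnd ℂ) (x k) * Y k l * x l).re + ‖x k‖ ^ 2 * ‖x l‖ ^ 2 := by
      simp only [← Complex.normSq_eq_norm_sq, Complex.normSq_apply, Complex.sub_re, Complex.sub_im,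
        Complex.mul_re, Complex.mul_im, Complex.conj_re, Complex.conj_im]
      ring
    rw [h4]; linarith
  rw [← Real.sqrt_mul (by
    have : 0 ≤ B := hgap.le.trans hBm
    positivity)]
  apply Real.sqrt_le_sqrt
  refine hF.trans ?_
  have hε1 : ε * (d : ℝ) ^ 2 ≤ N := by
    have h := hε.trans (min_le_left _ _)
    rwa [le_div_iff₀ (by positivity)] at h
  have hqb : N * T - q ≤ N * B * ε / m := by
    rw [le_div_iff₀ hgap]
    have := mul_le_mul_of_nonneg_left hAY hNpos.le
    linarith
  have hsq : (T - N) ^ 2 ≤ N * B * ε / m := by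
    have h1 : (T - N) ^ 2 ≤ (d * ε) ^ 2 := sq_le_sq' (abs_le.mp hTN).1 (abs_le.mp hTN).2
    have h2 : ((d : ℝ) * ε) ^ 2 ≤ N * ε := by
      calc ((d : ℝ) * ε) ^ 2 = (ε * (d : ℝ) ^ 2) * ε := by ring
        _ ≤ _ := mul_le_mul_of_nonneg_right hε1 hεpos.le
    refine h1.trans (h2.trans ?_)
    rw [le_div_iff₀ hgap]
    have := mul_le_mul_of_nonneg_left hBm (mul_pos hNpos hεpos).le
    linarith
  have : 3 * N * B / m * ε = 3 * (N * B * ε / m) := by ring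
  rw [this]
  nlinarith
end

section
/- Under the assumptions of the previous matrix completion statement (Y ⪰ 0 entry-wise ε-close to x xᴴ on D ∪ E, with ε ≤ min{|x|²/d², |x|²λ₂/(12B)} and λ₂ > 0), the matrix Y has a unique (simple) top eigenvalue, and its unit top eigenvector v satisfies min_{θ∈ℝ} |√(trace Y) · v − e^{iθ} x| ≤ (1 + 2√6 √(B/λ₂)) · √ε. -/
open Finset Matrix
open scoped ComplexOrder

lemma r1_spec {𝕜 : Type*} [RCLike 𝕜] {d : ℕ} {A : Matrix (Fin d) (Fin d) 𝕜} (hA : A.IsHermitian) :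
    ∃ q : Fin d → Fin d → 𝕜,
      (∀ j f, star (q j) ⬝ᵥ (A *ᵥ f) = (hA.eigenvalues j : 𝕜) * (star (q j) ⬝ᵥ f)) ∧
      (∀ j, A *ᵥ q j = (hA.eigenvalues j : 𝕜) • q j) ∧
      (∀ k l, ∑ j, q j k * star (q j l) = if k = l then 1 else 0) ∧
      (∀ f g : Fin d → 𝕜, star g ⬝ᵥ f = ∑ j, star (star (q j) ⬝ᵥ g) * (star (q j) ⬝ᵥ f)) := by
  have h2 : ∀ k l, ∑ j, (hA.eigenvectorBasis j) k * star ((hA.eigenvectorBasis j) l)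
      = if k = l then (1 : 𝕜) else 0 := by
    intro k l
    have := congrFun (congrFun (Unitary.coe_mul_star_self hA.eigenvectorUnitary) k) l
    simpa [Matrix.mul_apply, Matrix.one_apply, Matrix.star_apply] using this
  have h1 : ∀ j, A *ᵥ (hA.eigenvectorBasis j) = (hA.eigenvalues j : 𝕜) • ⇑(hA.eigenvectorBasis j) := by
    intro j
    rw [hA.mulVec_eigenvectorBasis j]
    ext k
    simp [RCLike.real_smul_eq_coe_mul]
  refine ⟨fun j => hA.eigenvectorBasis j, ?_, h1, h2, ?_⟩
  · intro j f
    rw [dotProduct_mulVec]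
    have : star (⇑(hA.eigenvectorBasis j)) ᵥ* A = star (A *ᵥ ⇑(hA.eigenvectorBasis j)) := by
      rw [star_mulVec, hA.eq]
    rw [this, h1]
    simp [RCLike.real_smul_eq_coe_mul]
  · intro f g
    have := hA.eigenvectorBasis.sum_inner_mul_inner (WithLp.toLp 2 g) (WithLp.toLp 2 f)
    simp only [EuclideanSpace.inner_eq_star_dotProduct] at this
    rw [dotProduct_comm, ← this]
    refine Finset.sum_congr rfl fun j _ => ?_
    rw [star_dotProduct, star_star, dotProduct_comm, dotProduct_comm f]

lemma r1_A {d : ℕ} {L : Matrix (Fin d) (Fin d) ℝ} (hL : L.IsHermitian)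
    (j0 : Fin d) (lam : ℝ) (hlam : 0 < lam) (hj : ∀ j, j ≠ j0 → lam ≤ hL.eigenvalues j)
    (a : Fin d → ℝ) (ha : L *ᵥ a = 0) (n : ℝ) (hn : 0 < n) (han : ∑ k, a k ^ 2 = n)
    (R : Matrix (Fin d) (Fin d) ℝ) (hR : ∀ f : Fin d → ℝ, 0 ≤ ∑ k, ∑ l, f k * f l * R k l) :
    lam * (n * ∑ k, R k k - ∑ k, ∑ l, a k * a l * R k l) ≤ n * ∑ k, ∑ l, L k l * R k l := by
  obtain ⟨q, h1, h2, h3, h4⟩ := r1_spec hL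
  simp only [star_trivial, RCLike.ofReal_real_eq_id, id_eq] at h1 h2 h3 h4
  have hc : ∀ j, j ≠ j0 → q j ⬝ᵥ a = 0 := by
    intro j hjj
    have := h1 j a
    rw [ha, dotProduct_zero] at this
    rcases mul_eq_zero.1 this.symm with h | h
    · have := hj j hjj; linarith
    · exact h
  have hac : ∀ k, a k = (q j0 ⬝ᵥ a) * q j0 k := by
    intro k
    have : ∑ j, (q j ⬝ᵥ a) * q j k = a k := by
      simp only [dotProduct, Finset.sum_mul]
      rw [Finset.sum_comm]
      have : ∀ m, ∑ j, q j m * a m * q j k = a m * (if m = k then 1 else 0) := by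
        intro m
        rw [← h3 m k, Finset.mul_sum]
        exact Finset.sum_congr rfl fun j _ => by ring
      simp [this]
    rw [← this, Finset.sum_eq_single j0]
    · intro j _ hjj; rw [hc j hjj, zero_mul]
    · simp
  have hc0 : (q j0 ⬝ᵥ a) ^ 2 = n := by
    have := h4 a a
    rw [Finset.sum_eq_single j0] at this
    · rw [← han, sq, ← this, dotProduct]
      exact Finset.sum_congr rfl fun j _ => by ring
    · intro j _ hjj; rw [hc j hjj, zero_mul]
    · simp
  set c := q j0 ⬝ᵥ a with hcdef
  have hcne : c ≠ 0 := by rintro h; rw [h] at hc0; simp at hc0; linarith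
  have hmu : hL.eigenvalues j0 = 0 := by
    have := h1 j0 a
    rw [ha, dotProduct_zero] at this
    rcases mul_eq_zero.1 this.symm with h | h
    · exact h
    · exact absurd h hcne
  set Q : Fin d → ℝ := fun j => ∑ k, ∑ l, q j k * q j l * R k l with hQ
  have hQ0 : ∀ j, 0 ≤ Q j := fun j => hR (q j)
  have hLs : ∑ k, ∑ l, L k l * R k l = ∑ j, hL.eigenvalues j * Q j := by
    have hLk : ∀ k l, L k l = ∑ j, hL.eigenvalues j * (q j k * q j l) := by
      intro k l
      have : ∀ j, hL.eigenvalues j * (q j k * q j l) = ∑ m, L k m * (q j m * q j l) := by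
        intro j
        have := congrFun (h2 j) k
        simp only [mulVec, dotProduct, Pi.smul_apply, smul_eq_mul] at this
        rw [← mul_assoc, ← this, Finset.sum_mul]
        exact Finset.sum_congr rfl fun j _ => by ring
      simp only [this]
      rw [Finset.sum_comm]
      simp only [← Finset.mul_sum, h3]
      simp
    simp only [hLk, hQ, Finset.mul_sum, Finset.sum_mul]
    rw [Finset.sum_comm' (t' := univ) (s' := fun _ => univ) (by simp)]
    rw [Finset.sum_comm]
    simp only [fun k => Finset.sum_comm (s := (univ : Finset (Fin d))) (t := univ) (f := fun l j => hL.eigenvalues j * (q j k * q j l) * R k l)]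
    rw [Finset.sum_comm]
    simp only [mul_assoc]
  have hTr : ∑ k, R k k = ∑ j, Q j := by
    have : ∀ k, R k k = ∑ l, (∑ j, q j k * q j l) * R k l := by
      intro k; simp [h3]
    rw [Finset.sum_congr rfl fun k _ => this k]
    simp only [hQ, Finset.sum_mul]
    simp only [fun k => Finset.sum_comm (s := (univ : Finset (Fin d))) (t := univ) (f := fun l j => (q j k * q j l) * R k l)]
    rw [Finset.sum_comm]
  have haR : ∑ k, ∑ l, a k * a l * R k l = n * Q j0 := by
    rw [hQ, ← hc0]
    simp only [Finset.mul_sum]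
    refine Finset.sum_congr rfl fun k _ => Finset.sum_congr rfl fun l _ => ?_
    rw [hac k, hac l]; ring
  rw [hLs, hTr, haR, ← Finset.add_sum_erase univ _ (mem_univ j0),
    ← Finset.add_sum_erase univ _ (mem_univ j0), hmu]
  have : lam * ∑ j ∈ univ.erase j0, Q j ≤ ∑ j ∈ univ.erase j0, hL.eigenvalues j * Q j := by
    rw [Finset.mul_sum]
    refine Finset.sum_le_sum fun j hjm => ?_
    exact mul_le_mul_of_nonneg_right (hj j (Finset.ne_of_mem_erase hjm)) (hQ0 j)
  nlinarith

lemma r1_norm {d : ℕ} (x : Fin d → ℂ) : star x ⬝ᵥ x = ((∑ i, ‖x i‖ ^ 2 : ℝ) : ℂ) := by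
  simp only [dotProduct, Pi.star_apply, RCLike.star_def, Complex.conj_mul', Complex.ofReal_sum,
    Complex.ofReal_pow]

lemma r1_B {d : ℕ} (x : Fin d → ℂ) (n : ℝ) (hn : 0 < n) (hxn : ∑ i, ‖x i‖ ^ 2 = n)
    (Y : Matrix (Fin d) (Fin d) ℂ) (hY : Y.PosSemidef) (T δ : ℝ) (hT : T = Y.trace.re)
    (hs : n * (T - δ) ≤ (star x ⬝ᵥ Y *ᵥ x).re) (hδ0 : 0 ≤ δ) (hδ : δ ≤ n / 12) (hTn : n / 2 ≤ T) :
    (∃ i, ∀ j, j ≠ i → hY.1.eigenvalues j < hY.1.eigenvalues i) ∧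
      ∀ (i : Fin d) (v : Fin d → ℂ),
        (∀ j, hY.1.eigenvalues j ≤ hY.1.eigenvalues i) →
        (∑ j, ‖v j‖ ^ 2) = 1 →
        Y *ᵥ v = ((hY.1.eigenvalues i : ℝ) : ℂ) • v →
        n - ‖star x ⬝ᵥ v‖ ^ 2 ≤ 12 * δ / 5 ∧ ‖star x ⬝ᵥ v‖ ^ 2 ≤ n := by
  obtain ⟨q, h1, h2, h3, h4⟩ := r1_spec hY.1
  have hpos : ∀ j, 0 ≤ hY.1.eigenvalues j := hY.eigenvalues_nonneg
  have htr : ∑ j, hY.1.eigenvalues j = T := by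
    rw [hT, hY.1.trace_eq_sum_eigenvalues]
    simp
  have par : ∀ f : Fin d → ℂ, ∑ j, ‖star (q j) ⬝ᵥ f‖ ^ 2 = ∑ i, ‖f i‖ ^ 2 := by
    intro f
    have := h4 f f
    rw [r1_norm] at this
    simp only [RCLike.star_def, Complex.conj_mul'] at this
    exact_mod_cast this.symm
  have hsq : (star x ⬝ᵥ Y *ᵥ x).re = ∑ j, hY.1.eigenvalues j * ‖star (q j) ⬝ᵥ x‖ ^ 2 := by
    have : star x ⬝ᵥ Y *ᵥ x = ((∑ j, hY.1.eigenvalues j * ‖star (q j) ⬝ᵥ x‖ ^ 2 : ℝ) : ℂ) := by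
      rw [h4 (Y *ᵥ x) x]
      push_cast
      refine Finset.sum_congr rfl fun j _ => ?_
      rw [h1, ← Complex.conj_mul']
      simp only [RCLike.star_def, Complex.coe_algebraMap, RCLike.ofReal_eq_complex_ofReal]
      ring
    rw [this, Complex.ofReal_re]
  have hw := par x
  rw [hxn] at hw
  set w : Fin d → ℝ := fun j => ‖star (q j) ⬝ᵥ x‖ ^ 2 with hwdef
  change ∑ j, w j = n at hw
  have hsq' : n * (T - δ) ≤ ∑ j, hY.1.eigenvalues j * w j := by rw [← hsq]; exact hs
  have hw0 : ∀ j, 0 ≤ w j := fun j => by positivity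
  set lam := hY.1.eigenvalues with hlam
  have htop : ∀ i, (∀ j, lam j ≤ lam i) → T - δ ≤ lam i := by
    intro i hi
    have : ∑ j, lam j * w j ≤ lam i * n := by
      rw [← hw, Finset.mul_sum]
      exact Finset.sum_le_sum fun j _ => mul_le_mul_of_nonneg_right (hi j) (hw0 j)
    by_contra! h
    nlinarith
  have hoth : ∀ i, (∀ j, lam j ≤ lam i) → ∀ j, j ≠ i → lam j ≤ T - lam i := by
    intro i hi j hj
    have : lam i + lam j ≤ T := by
      rw [← htr, ← Finset.sum_pair hj.symm]
      exact Finset.sum_le_sum_of_subset_of_nonneg (by simp) fun k _ _ => hpos k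
    linarith
  have hlt : ∀ i, (∀ j, lam j ≤ lam i) → ∀ j, j ≠ i → lam j < lam i := by
    intro i hi j hj
    have := hoth i hi j hj
    have := htop i hi
    linarith
  refine ⟨?_, ?_⟩
  · have hne : Nonempty (Fin d) := by
      by_contra h
      rw [not_nonempty_iff] at h
      simp at hw
      linarith
    obtain ⟨i, hi⟩ := Finite.exists_max lam
    exact ⟨i, hlt i hi⟩
  · intro i v hi hv hYv
    have hcv : ∀ j, j ≠ i → star (q j) ⬝ᵥ v = 0 := by
      intro j hj
      have := h1 j v
      rw [hYv, dotProduct_smul, smul_eq_mul] at this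
      have hne : (lam i : ℂ) ≠ (lam j : ℂ) := by
        have := hlt i hi j hj
        exact_mod_cast this.ne'
      have h0 : ((lam i : ℂ) - lam j) * (star (q j) ⬝ᵥ v) = 0 := by
        rw [sub_mul, this]
        simp [hlam]
      rcases mul_eq_zero.1 h0 with h | h
      · exact absurd (sub_eq_zero.1 h) hne
      · exact h
    have hv1 : ‖star (q i) ⬝ᵥ v‖ ^ 2 = 1 := by
      have := par v
      rw [hv, Finset.sum_eq_single i] at this
      · exact this
      · intro j _ hj; rw [hcv j hj]; simp
      · simp
    have hh : ‖star x ⬝ᵥ v‖ ^ 2 = w i := by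
      rw [h4 v x, Finset.sum_eq_single i]
      · rw [norm_mul, mul_pow, hv1, norm_star, mul_one]
      · intro j _ hj; rw [hcv j hj]; simp
      · simp
    rw [hh]
    have hwi : w i ≤ n := by
      rw [← hw]; exact Finset.single_le_sum (fun j _ => hw0 j) (mem_univ i)
    refine ⟨?_, hwi⟩
    have hTl := htop i hi
    have hlT : lam i ≤ T := by
      rw [← htr]; exact Finset.single_le_sum (fun j _ => hpos j) (mem_univ i)
    have hrest : ∑ j ∈ univ.erase i, lam j * w j ≤ δ * ∑ j ∈ univ.erase i, w j := by
      rw [Finset.mul_sum]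
      refine Finset.sum_le_sum fun j hj => mul_le_mul_of_nonneg_right ?_ (hw0 j)
      have := hoth i hi j (Finset.ne_of_mem_erase hj)
      linarith
    rw [← Finset.add_sum_erase univ _ (mem_univ i)] at hw hsq'
    have e1 : ∑ j ∈ univ.erase i, w j = n - w i := by linarith
    rw [e1] at hrest
    have e2 : lam i * w i ≤ T * w i := mul_le_mul_of_nonneg_right hlT (hw0 i)
    have e3 : (n - w i) * (T - δ) ≤ n * δ := by nlinarith
    have e4 : (n - w i) * (5 * n / 12) ≤ (n - w i) * (T - δ) :=
      mul_le_mul_of_nonneg_left (by linarith) (by linarith)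
    by_contra! h
    nlinarith

lemma r1_C {d : ℕ} (x v : Fin d → ℂ) (n T ε δ : ℝ) (hn : 0 < n) (hxn : ∑ i, ‖x i‖ ^ 2 = n)
    (hv : ∑ j, ‖v j‖ ^ 2 = 1) (hε : 0 ≤ ε) (hδ : 0 ≤ δ) (hT0 : 0 ≤ T) (hT : T ≤ 4 * n)
    (hTn : (T - n) ^ 2 ≤ n * ε)
    (h1 : n - ‖star x ⬝ᵥ v‖ ^ 2 ≤ 12 * δ / 5) (h2 : ‖star x ⬝ᵥ v‖ ^ 2 ≤ n) :
    ∃ θ : ℝ, ∑ j, ‖((Real.sqrt T : ℝ) : ℂ) * v j - Complex.exp ((θ : ℂ) * Complex.I) * x j‖ ^ 2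
      ≤ ε + 24 * δ := by
  set h := star x ⬝ᵥ v with hh
  refine ⟨Complex.arg h, ?_⟩
  set E := Complex.exp ((Complex.arg h : ℂ) * Complex.I) with hE
  have hEn : ‖E‖ = 1 := Complex.norm_exp_ofReal_mul_I _
  have hEh : (starRingEnd ℂ E * h).re = ‖h‖ := by
    have : (‖h‖ : ℂ) * E = h := Complex.norm_mul_exp_arg_mul_I h
    have h3 : starRingEnd ℂ E * h = ‖h‖ := by
      calc starRingEnd ℂ E * h = starRingEnd ℂ E * ((‖h‖ : ℂ) * E) := by rw [this]
        _ = (starRingEnd ℂ E * E) * ‖h‖ := by ring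
        _ = ‖h‖ := by rw [Complex.conj_mul', hEn]; simp
    rw [h3, Complex.ofReal_re]
  have hsum : ∑ j, ‖((Real.sqrt T : ℝ) : ℂ) * v j - E * x j‖ ^ 2
      = T + n - 2 * Real.sqrt T * ‖h‖ := by
    have : ∀ j, ‖((Real.sqrt T : ℝ) : ℂ) * v j - E * x j‖ ^ 2 = T * ‖v j‖ ^ 2 + ‖x j‖ ^ 2
        - 2 * Real.sqrt T * (starRingEnd ℂ E * (starRingEnd ℂ (x j) * v j)).re := by
      intro j
      rw [← Complex.normSq_eq_norm_sq, Complex.normSq_sub, Complex.normSq_eq_norm_sq,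
        Complex.normSq_eq_norm_sq, norm_mul, norm_mul, hEn, Complex.norm_real, mul_pow,
        Real.norm_eq_abs, sq_abs, Real.sq_sqrt hT0, one_mul, map_mul]
      have : ((Real.sqrt T : ℝ) : ℂ) * v j * (starRingEnd ℂ E * starRingEnd ℂ (x j))
        = ((Real.sqrt T : ℝ) : ℂ) * (starRingEnd ℂ E * (starRingEnd ℂ (x j) * v j)) := by ring
      rw [this, Complex.re_ofReal_mul]
      ring
    simp only [this]
    rw [Finset.sum_sub_distrib, Finset.sum_add_distrib, ← Finset.mul_sum, ← Finset.mul_sum, hv, hxn,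
      ← Complex.re_sum, ← Finset.mul_sum]
    have : ∑ j, starRingEnd ℂ (x j) * v j = h := rfl
    rw [this, hEh]; ring
  rw [hsum]
  have hh0 : 0 ≤ ‖h‖ := norm_nonneg _
  set m := ‖h‖
  obtain ⟨r, hr0, hr⟩ : ∃ r, 0 < r ∧ r ^ 2 = n := ⟨Real.sqrt n, Real.sqrt_pos.2 hn, Real.sq_sqrt hn.le⟩
  obtain ⟨t, ht0, ht, htt⟩ : ∃ t, 0 ≤ t ∧ t ^ 2 = T ∧ Real.sqrt T = t :=
    ⟨Real.sqrt T, Real.sqrt_nonneg _, Real.sq_sqrt hT0, rfl⟩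
  rw [htt]
  subst hr ht
  have hmr : m ≤ r := by nlinarith
  have htr : t ≤ 2 * r := by nlinarith
  have e1 : (t - r) ^ 2 ≤ ε := by
    have : (t - r) ^ 2 * r ^ 2 ≤ (t ^ 2 - r ^ 2) ^ 2 := by
      have : (t ^ 2 - r ^ 2) ^ 2 = (t - r) ^ 2 * (t + r) ^ 2 := by ring
      rw [this]
      exact mul_le_mul_of_nonneg_left (by nlinarith) (sq_nonneg _)
    by_contra! hc
    nlinarith
  have e2 : t * (r - m) ≤ 2 * r * (r - m) := mul_le_mul_of_nonneg_right htr (by linarith)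
  have e3 : r * (r - m) ≤ r ^ 2 - m ^ 2 := by nlinarith
  nlinarith

lemma r1_Lap {d : ℕ} (G : SimpleGraph (Fin d)) [DecidableRel G.Adj] (a : Fin d → ℝ)
    (ha : ∀ i, 0 ≤ a i) : weightedLaplacian G (fun i => a i ^ 2) *ᵥ a = 0 := by
  ext u
  simp only [mulVec, dotProduct, Pi.zero_apply]
  have : ∀ l, weightedLaplacian G (fun i => a i ^ 2) u l * a l =
      (if u = l then (∑ z ∈ G.neighborFinset u, a z ^ 2) * a l else 0) -
      (if G.Adj u l then a u * a l ^ 2 else 0) := by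
    intro l
    unfold weightedLaplacian
    by_cases h : u = l
    · subst h; simp
    · by_cases h' : G.Adj u l
      · simp only [h, h', if_true, if_false]
        rw [← mul_pow, Real.sqrt_sq (mul_nonneg (ha u) (ha l))]; ring
      · simp [h, h']
  simp only [this]
  rw [Finset.sum_sub_distrib, ← Finset.sum_filter, ← Finset.sum_filter]
  have h2 : univ.filter (fun l => G.Adj u l) = G.neighborFinset u := by ext; simp
  rw [h2]
  simp only [Finset.filter_eq, mem_univ, if_true, Finset.sum_singleton]
  rw [mul_comm, Finset.mul_sum, sub_self]

/-- Rank-one matrix completion, de-lifting step: under the assumptions of the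
Frobenius-error matrix completion theorem (`Y ⪰ 0` entrywise `ε`-close to
`x xᴴ` on the diagonal and edges, `ε ≤ min{|x|²/d², |x|²λ₂/(12B)}`, `λ₂ > 0`),
`Y` has a simple (unique) top eigenvalue, and every unit top eigenvector `v`
satisfies `min_{θ∈ℝ} |√(trace Y)·v − e^{iθ}x| ≤ (1 + 2√6 √(B/λ₂))·√ε`. -/
theorem rank_one_completion_top_eigenvector {d : ℕ} (hd : 1 < d)
    (x : Fin d → ℂ) (hx : x ≠ 0)
    (G : SimpleGraph (Fin d)) [DecidableRel G.Adj]
    (hH : (weightedLaplacian G (fun i => ‖x i‖ ^ 2)).IsHermitian)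
    (e : Fin d → ℝ) (hmono : Monotone e)
    (hperm : ∃ σ : Equiv.Perm (Fin d), e = hH.eigenvalues ∘ σ)
    (hgap : 0 < e ⟨1, hd⟩)
    (B : ℝ) (hB : B = ∑ k, ∑ l, |weightedLaplacian G (fun i => ‖x i‖ ^ 2) k l|)
    (ε : ℝ) (hεpos : 0 < ε)
    (hε : ε ≤ min ((∑ i, ‖x i‖ ^ 2) / (d : ℝ) ^ 2)
      ((∑ i, ‖x i‖ ^ 2) * e ⟨1, hd⟩ / (12 * B)))
    (Y : Matrix (Fin d) (Fin d) ℂ) (hY : Y.PosSemidef)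
    (hclose : ∀ k l, (k = l ∨ G.Adj k l) →
      ‖Y k l - x k * (starRingEnd ℂ) (x l)‖ ≤ ε) :
    (∃ i, ∀ j, j ≠ i → hY.1.eigenvalues j < hY.1.eigenvalues i) ∧
      ∀ (i : Fin d) (v : Fin d → ℂ),
        (∀ j, hY.1.eigenvalues j ≤ hY.1.eigenvalues i) →
        (∑ j, ‖v j‖ ^ 2) = 1 →
        Y *ᵥ v = ((hY.1.eigenvalues i : ℝ) : ℂ) • v →
        ∃ θ : ℝ,
          Real.sqrt (∑ j, ‖((Real.sqrt Y.trace.re : ℝ) : ℂ) * v j -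
              Complex.exp ((θ : ℂ) * Complex.I) * x j‖ ^ 2) ≤
            (1 + 2 * Real.sqrt 6 * Real.sqrt (B / e ⟨1, hd⟩)) * Real.sqrt ε := by
  have hεa := hε.trans (min_le_left _ _)
  have hεb := hε.trans (min_le_right _ _)
  obtain ⟨n, hxn⟩ : ∃ n, ∑ i, ‖x i‖ ^ 2 = n := ⟨_, rfl⟩
  rw [hxn] at hεa hεb
  have hn : 0 < n := by
    rw [← hxn]
    obtain ⟨k, hk⟩ := Function.ne_iff.1 hx
    refine Finset.sum_pos' (fun i _ => by positivity) ⟨k, mem_univ k, ?_⟩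
    have : 0 < ‖x k‖ := norm_pos_iff.2 hk
    positivity
  have hL := r1_Lap G (fun i => ‖x i‖) (fun i => norm_nonneg _)
  set L := weightedLaplacian G (fun i => ‖x i‖ ^ 2) with hLdef
  set lam := e ⟨1, hd⟩ with hlam
  have hB0 : 0 ≤ B := by
    rw [hB]; exact Finset.sum_nonneg fun k _ => Finset.sum_nonneg fun l _ => abs_nonneg _
  have hBpos : 0 < B := by
    rcases hB0.lt_or_eq with h | h
    · exact h
    · rw [← h] at hεb; simp at hεb; linarith
  obtain ⟨σ, hσ⟩ := hperm
  have hj : ∀ j, j ≠ σ ⟨0, by omega⟩ → lam ≤ hH.eigenvalues j := by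
    intro j hj
    have h1 : hH.eigenvalues j = e (σ.symm j) := by rw [hσ]; simp
    rw [h1, hlam]
    apply hmono
    rw [Fin.le_def]
    have : σ.symm j ≠ ⟨0, by omega⟩ := fun h => hj (by rw [← h]; simp)
    have : (σ.symm j).val ≠ 0 := fun h => this (Fin.ext h)
    change 1 ≤ (σ.symm j).val
    omega
  -- phases
  have hph : ∀ k, ∃ p : ℂ, ‖p‖ = 1 ∧ (‖x k‖ : ℂ) * p = x k := fun k =>
    ⟨Complex.exp ((Complex.arg (x k) : ℂ) * Complex.I), Complex.norm_exp_ofReal_mul_I _,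
      Complex.norm_mul_exp_arg_mul_I _⟩
  choose p hp1 hpx using hph
  set R : Matrix (Fin d) (Fin d) ℝ := fun k l => (starRingEnd ℂ (p k) * Y k l * p l).re with hR
  have hquad : ∀ f : Fin d → ℝ, ∑ k, ∑ l, f k * f l * R k l =
      (star (fun k => (f k : ℂ) * p k) ⬝ᵥ Y *ᵥ (fun k => (f k : ℂ) * p k)).re := by
    intro f
    simp only [dotProduct, mulVec, Finset.mul_sum, Complex.re_sum]
    refine Finset.sum_congr rfl fun k _ => Finset.sum_congr rfl fun l _ => ?_
    rw [hR, ← Complex.re_ofReal_mul]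
    congr 1
    simp only [Pi.star_apply, RCLike.star_def, map_mul, Complex.conj_ofReal]
    push_cast
    ring
  have hRpos : ∀ f : Fin d → ℝ, 0 ≤ ∑ k, ∑ l, f k * f l * R k l := by
    intro f
    rw [hquad]
    exact (Complex.le_def.1 (hY.dotProduct_mulVec_nonneg _)).1
  have hA := r1_A hH (σ ⟨0, by omega⟩) lam hgap hj (fun i => ‖x i‖) hL n hn hxn R hRpos
  rw [hquad] at hA
  have hpx' : (fun k => ((‖x k‖ : ℝ) : ℂ) * p k) = x := funext hpx
  rw [hpx'] at hA
  have hRkk : ∀ k, R k k = (Y k k).re := by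
    intro k
    have : starRingEnd ℂ (p k) * Y k k * p k = (starRingEnd ℂ (p k) * p k) * Y k k := by ring
    simp only [hR]
    rw [this, Complex.conj_mul', hp1]; simp
  have htr : ∑ k, R k k = Y.trace.re := by
    simp only [hRkk, Matrix.trace, Matrix.diag_apply, Complex.re_sum]
  have hLR : ∑ k, ∑ l, L k l * R k l ≤ B * ε := by
    have h0 : ∑ k, ∑ l, L k l * (‖x k‖ * ‖x l‖) = 0 := by
      refine Finset.sum_eq_zero fun k _ => ?_
      have := congrFun hL k
      simp only [mulVec, dotProduct, Pi.zero_apply] at this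
      rw [← mul_zero ‖x k‖, ← this, Finset.mul_sum]
      exact Finset.sum_congr rfl fun l _ => by ring
    have h1 : ∑ k, ∑ l, L k l * R k l = ∑ k, ∑ l, L k l * (R k l - ‖x k‖ * ‖x l‖) := by
      simp only [mul_sub, Finset.sum_sub_distrib]
      rw [h0, sub_zero]
    rw [h1, hB]
    simp only [Finset.sum_mul]
    refine Finset.sum_le_sum fun k _ => Finset.sum_le_sum fun l _ => ?_
    by_cases hkl : k = l ∨ G.Adj k l
    · have h2 : R k l - ‖x k‖ * ‖x l‖ =
          (starRingEnd ℂ (p k) * (Y k l - x k * (starRingEnd ℂ) (x l)) * p l).re := by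
        have h3 : starRingEnd ℂ (p k) * (x k * (starRingEnd ℂ) (x l)) * p l
            = ((‖x k‖ * ‖x l‖ : ℝ) : ℂ) := by
          calc starRingEnd ℂ (p k) * (x k * (starRingEnd ℂ) (x l)) * p l
              = starRingEnd ℂ (p k) * (((‖x k‖ : ℂ) * p k) * (starRingEnd ℂ) ((‖x l‖ : ℂ) * p l))
                * p l := by rw [hpx, hpx]
            _ = (starRingEnd ℂ (p k) * p k) * (starRingEnd ℂ (p l) * p l) * (‖x k‖ * ‖x l‖) := by
                rw [map_mul, Complex.conj_ofReal]; ring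
            _ = _ := by rw [Complex.conj_mul', Complex.conj_mul', hp1, hp1]; simp
        rw [mul_sub, sub_mul, h3, Complex.sub_re, Complex.ofReal_re]
      have h4 : |R k l - ‖x k‖ * ‖x l‖| ≤ ε := by
        rw [h2]
        refine (Complex.abs_re_le_norm _).trans ?_
        rw [norm_mul, norm_mul, RCLike.norm_conj, hp1, hp1, one_mul, mul_one]
        exact hclose k l hkl
      calc L k l * (R k l - ‖x k‖ * ‖x l‖) ≤ |L k l * (R k l - ‖x k‖ * ‖x l‖)| := le_abs_self _
        _ = |L k l| * |R k l - ‖x k‖ * ‖x l‖| := abs_mul _ _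
        _ ≤ |L k l| * ε := mul_le_mul_of_nonneg_left h4 (abs_nonneg _)
    · push Not at hkl
      have : L k l = 0 := by
        rw [hLdef]; unfold weightedLaplacian; simp [hkl.1, hkl.2]
      simp [this]
  rw [htr] at hA
  have hTn : |Y.trace.re - n| ≤ d * ε := by
    rw [← htr, ← hxn, ← Finset.sum_sub_distrib]
    refine (Finset.abs_sum_le_sum_abs _ _).trans ?_
    refine (Finset.sum_le_card_nsmul univ _ ε fun k _ => ?_).trans (by simp)
    rw [hRkk]
    have h1 := hclose k k (Or.inl rfl)
    refine le_trans ?_ h1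
    refine le_trans (le_of_eq ?_) (Complex.abs_re_le_norm _)
    rw [Complex.sub_re, Complex.mul_conj', ← Complex.ofReal_pow, Complex.ofReal_re]
  set T := Y.trace.re with hT
  have hdR : (2 : ℝ) ≤ d := by exact_mod_cast hd
  rw [le_div_iff₀ (by positivity)] at hεa
  rw [le_div_iff₀ (by positivity)] at hεb
  have hdε : d * ε ≤ n / 2 := by nlinarith [mul_nonneg (mul_nonneg (by linarith : (0:ℝ) ≤ d) hεpos.le) (by linarith : (0:ℝ) ≤ d - 2)]
  obtain ⟨hTa, hTb⟩ := abs_le.1 hTn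
  obtain ⟨δ, hδ⟩ : ∃ δ, δ = B / lam * ε := ⟨_, rfl⟩
  have hδl : lam * δ = B * ε := by rw [hδ]; field_simp
  have hδ0 : 0 ≤ δ := by rw [hδ]; positivity
  have hδn : δ ≤ n / 12 := by
    by_contra! h
    nlinarith
  have hs : n * (T - δ) ≤ (star x ⬝ᵥ Y *ᵥ x).re := by
    by_contra! h
    nlinarith
  obtain ⟨hB1, hB2⟩ := r1_B x n hn hxn Y hY T δ hT hs hδ0 hδn (by linarith)
  refine ⟨hB1, fun i v hi hv hYv => ?_⟩
  obtain ⟨h1, h2⟩ := hB2 i v hi hv hYv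
  have hTsq : (T - n) ^ 2 ≤ n * ε := by
    have : (T - n) ^ 2 ≤ (d * ε) ^ 2 := sq_le_sq' hTa hTb
    nlinarith
  obtain ⟨θ, hθ⟩ := r1_C x v n T ε δ hn hxn hv hεpos.le hδ0 (by linarith) (by linarith) hTsq h1 h2
  refine ⟨θ, ?_⟩
  refine Real.sqrt_le_iff.2 ⟨by positivity, hθ.trans ?_⟩
  have s1 : Real.sqrt 6 ^ 2 = 6 := Real.sq_sqrt (by norm_num)
  have s2 : Real.sqrt (B / lam) ^ 2 = B / lam := Real.sq_sqrt (by positivity)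
  have s3 : Real.sqrt ε ^ 2 = ε := Real.sq_sqrt hεpos.le
  have s4 : 0 ≤ Real.sqrt 6 * Real.sqrt (B / lam) := by positivity
  have s5 : ((1 + 2 * Real.sqrt 6 * Real.sqrt (B / lam)) * Real.sqrt ε) ^ 2
      = ε + 24 * δ + 4 * (Real.sqrt 6 * Real.sqrt (B / lam)) * ε := by
    rw [mul_pow, s3, hδ]
    linear_combination ε * (4 * Real.sqrt (B / lam) ^ 2 * s1 + 24 * s2)
  rw [s5]
  have := mul_nonneg s4 hεpos.le
  linarith
end

section
/- The canonical dual window ψ of the Gaussian Gabor frame (π(λ)φ)_{λ∈(1/√2)ℤ²} satisfies the pointwise bound |ψ(t)| ≤ e^{-π|t|/√2} for all t ∈ ℝ. -/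
open Real

/-- The Jacobi theta function `θ₃(x, e^{-π}) = Σ_{k∈ℤ} e^{-πk²} e^{2ikx}`
(real-valued for real `x`). -/
noncomputable def theta3 (x : ℝ) : ℝ :=
  ∑' k : ℤ, Real.exp (-π * (k : ℝ) ^ 2) * Real.cos (2 * (k : ℝ) * x)

/-- The denominator `Σ_{n∈ℤ}(−1)^n (n+1/2) e^{-π(n+1/2)²}` in Janssen's
formula for the coefficients of the dual window. -/
noncomputable def janssenDen : ℝ :=
  ∑' n : ℤ, (-1 : ℝ) ^ n * ((n : ℝ) + 1 / 2) * Real.exp (-π * ((n : ℝ) + 1 / 2) ^ 2)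

/-- Janssen's coefficients
`c_k = [Σ_{m≥0}(−1)^{k+m} e^{-π(m+1/2)(2|k|+m+1/2)}] / janssenDen`. -/
noncomputable def janssenCoeff (k : ℤ) : ℝ :=
  (∑' m : ℕ, (-1 : ℝ) ^ k * (-1 : ℝ) ^ m *
      Real.exp (-π * ((m : ℝ) + 1 / 2) * (2 * |(k : ℝ)| + (m : ℝ) + 1 / 2))) / janssenDen

/-- The canonical dual window `ψ` of the Gaussian Gabor frame
`(π(λ)φ)_{λ∈(1/√2)ℤ²}`, `φ(t) = 2^{1/4}e^{-πt²}`, via Janssen's formula: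
`ψ(t) = (1/(2θ₃(√2 πt, e^{-π}))) Σ_{k∈ℤ} c_k φ(t − √2 k)`. -/
noncomputable def dualWindow (t : ℝ) : ℝ :=
  (1 / (2 * theta3 (Real.sqrt 2 * π * t))) *
    ∑' k : ℤ, janssenCoeff k *
      (2 ^ ((1 : ℝ) / 4) * Real.exp (-π * (t - Real.sqrt 2 * (k : ℝ)) ^ 2))

open HurwitzZeta in
lemma aux_cosK (a : ℝ) {s : ℝ} (hs : 0 < s) :
    |cosKernel a s - 1| ≤ 2 * Real.exp (-π * s) / (1 - Real.exp (-π * s)) := by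
  have h := hasSum_nat_cosKernel₀ a hs
  have hq1 : Real.exp (-π * s) < 1 := by
    rw [Real.exp_lt_one_iff]; nlinarith [Real.pi_pos]
  have hg := (hasSum_geometric_of_lt_one (Real.exp_pos (-π * s)).le hq1).mul_left
    (2 * Real.exp (-π * s))
  rw [← div_eq_mul_inv] at hg
  have := h.norm_le_of_bounded hg (fun n => ?_)
  · simpa using this
  · rw [norm_mul, norm_mul, Real.norm_eq_abs, Real.norm_eq_abs, Real.norm_eq_abs,
      abs_of_pos (Real.exp_pos _), abs_of_pos (by norm_num : (0:ℝ) < 2), mul_assoc 2 |_|, mul_assoc 2 (Real.exp _),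
      ← Real.exp_nat_mul, ← Real.exp_add]
    have h1 := Real.abs_cos_le_one (2 * π * a * (n + 1))
    have h2 : Real.exp (-π * (n + 1) ^ 2 * s) ≤ Real.exp (-π * s + n * (-π * s)) := by
      apply Real.exp_le_exp.2
      have : 0 ≤ π * s * ((n:ℝ) ^ 2 + n) := by have := Real.pi_pos; positivity
      nlinarith
    have h3 := Real.exp_pos (-π * (n + 1) ^ 2 * s)
    nlinarith [abs_nonneg (Real.cos (2 * π * a * (n + 1)))]

open HurwitzZeta in
lemma aux_theta3 (x : ℝ) : theta3 x = cosKernel ((x / π : ℝ) : UnitAddCircle) 1 := by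
  have h := Complex.hasSum_re (hasSum_int_cosKernel (x / π) one_pos)
  rw [Complex.ofReal_re] at h
  rw [← h.tsum_eq, theta3]
  congr 1
  ext k
  rw [Complex.re_mul_ofReal]
  have : (2 * (π:ℂ) * Complex.I * ((x / π : ℝ) : ℂ) * (k:ℂ)) = ((2 * (k:ℝ) * x : ℝ) : ℂ) * Complex.I := by
    push_cast
    have : (π:ℂ) ≠ 0 := by exact_mod_cast Real.pi_ne_zero
    field_simp
  rw [this, Complex.exp_ofReal_mul_I_re, mul_comm]
  simp

open HurwitzZeta in
lemma aux_cos_mono (a : ℝ) {s : ℝ} (hs : 0 < s) : cosKernel a s ≤ cosKernel (0 : ℝ) s := by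
  have := hasSum_le (fun n => ?_) (hasSum_nat_cosKernel₀ a hs) (hasSum_nat_cosKernel₀ 0 hs)
  · linarith
  · gcongr
    simpa using Real.cos_le_one _

open HurwitzZeta in
lemma aux_even (a : ℝ) : evenKernel a 2 ≤
    1 + 2 * Real.exp (-π * 2) / (1 - Real.exp (-π * 2)) := by
  have h0 : evenKernel a 2 ≤ evenKernel (0 : ℝ) 2 := by
    rw [evenKernel_functional_equation, evenKernel_functional_equation]
    gcongr
    exact aux_cos_mono a (by norm_num)
  have h1 : evenKernel (0 : ℝ) 2 = cosKernel (0 : ℝ) 2 := by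
    have := evenKernel_eq_cosKernel_of_zero
    simp [this]
  have := (abs_le.1 (aux_cosK 0 (by norm_num : (0:ℝ) < 2))).2
  linarith

lemma aux_q : Real.exp (-π) ≤ 0.0434 := by
  have h1 : Real.exp (-π) ≤ Real.exp (-3.14) := by
    apply Real.exp_le_exp.2; linarith [Real.pi_gt_d2]
  have h2 : Real.exp (-3.14) = (Real.exp 1 ^ 3 * Real.exp 0.14)⁻¹ := by
    rw [← Real.exp_nat_mul, ← Real.exp_add, ← Real.exp_neg]; norm_num
  have h3 : (1.1497 : ℝ) ≤ Real.exp 0.14 := by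
    have := Real.quadratic_le_exp_of_nonneg (by norm_num : (0:ℝ) ≤ 0.14)
    norm_num at this ⊢; linarith
  have h4 : (2.718 : ℝ) ^ 3 ≤ Real.exp 1 ^ 3 := by
    gcongr; linarith [Real.exp_one_gt_d9]
  rw [h2] at h1
  refine h1.trans ?_
  have h5 : (2.718 : ℝ) ^ 3 * 1.1497 ≤ Real.exp 1 ^ 3 * Real.exp 0.14 := by gcongr
  refine (inv_anti₀ (by norm_num) h5).trans (by norm_num)

lemma aux_r : Real.exp (-π * 2) ≤ 0.0019 := by
  have h : Real.exp (-π * 2) = Real.exp (-π) ^ 2 := by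
    rw [← Real.exp_nat_mul]; congr 1; push_cast; ring
  have := aux_q
  rw [h]
  nlinarith [Real.exp_pos (-π)]

lemma aux_e8 : Real.exp (π / 8) ≤ 1.484 := by
  have h1 : Real.exp (π / 8) ^ 8 ≤ 1.484 ^ 8 := by
    have e : Real.exp (π / 8) ^ 8 = Real.exp π := by
      rw [← Real.exp_nat_mul]; congr 1; push_cast; ring
    have h2 : Real.exp π ≤ Real.exp 1 ^ 3 * Real.exp 0.1416 := by
      rw [← Real.exp_nat_mul, ← Real.exp_add]
      apply Real.exp_le_exp.2
      have := Real.pi_lt_d4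
      norm_num; linarith
    have h3 : Real.exp 0.1416 ≤ (1 - 0.1416)⁻¹ := by
      rw [show (0.1416:ℝ) = -(-0.1416) by norm_num, Real.exp_neg]
      apply inv_anti₀ (by norm_num)
      have := Real.add_one_le_exp (-0.1416)
      linarith
    have h4 : Real.exp 1 ^ 3 ≤ (2.7183 : ℝ) ^ 3 := by
      gcongr; linarith [Real.exp_one_lt_d9]
    rw [e]
    calc _ ≤ _ := h2
      _ ≤ (2.7183 : ℝ) ^ 3 * (1 - 0.1416)⁻¹ := by gcongr
      _ ≤ _ := by norm_num
  exact le_of_pow_le_pow_left₀ (by norm_num) (by norm_num) h1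

lemma aux_2 : (2 : ℝ) ^ ((1 : ℝ) / 4) ≤ 1.19 := by
  have h1 : ((2 : ℝ) ^ ((1 : ℝ) / 4)) ^ 4 ≤ 1.19 ^ 4 := by
    rw [← Real.rpow_natCast, ← Real.rpow_mul (by norm_num)]; norm_num
  exact le_of_pow_le_pow_left₀ (by norm_num) (by norm_num) h1

lemma aux_theta_low (x : ℝ) : 0.909 ≤ theta3 x := by
  rw [aux_theta3]
  have h := (abs_le.1 (aux_cosK (x / π) one_pos)).1
  rw [mul_one] at h
  have hq := aux_q
  have : 2 * Real.exp (-π) / (1 - Real.exp (-π)) ≤ 0.091 := by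
    rw [div_le_iff₀ (by linarith)]; linarith
  linarith

lemma aux_3 (n : ℕ) : (n:ℝ) + 1 + 1 / 2 ≤ 3 / 2 * 3 ^ n := by
  induction n with
  | zero => norm_num
  | succ n ih =>
    push_cast; rw [pow_succ]
    have : (0:ℝ) ≤ n := Nat.cast_nonneg n
    linarith

lemma aux_den : 0.994 * Real.exp (-π / 4) ≤ janssenDen := by
  set r := Real.exp (-π * 2) with hr
  have hr0 : 0 < r := Real.exp_pos _
  have hr1 : r ≤ 0.0019 := aux_r
  set f : ℤ → ℝ := fun n => (-1 : ℝ) ^ n * ((n : ℝ) + 1 / 2) * Real.exp (-π * ((n : ℝ) + 1 / 2) ^ 2) with hf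
  have hsymm : ∀ n : ℕ, f (-((n:ℤ) + 1)) = f n := by
    intro n
    simp only [hf]
    rw [neg_add, zpow_add₀ (by norm_num), zpow_neg, zpow_natCast, ← inv_pow]
    push_cast
    rw [show (-(n:ℝ) + -1 + 1/2) ^ 2 = ((n:ℝ) + 1/2)^2 by ring]
    norm_num
    ring
  have hb : ∀ n : ℕ, ‖f ((n + 1 : ℕ) : ℤ)‖ ≤ (3 / 2 * r * Real.exp (-π / 4)) * (3 * r) ^ n := by
    intro n
    simp only [hf]
    rw [norm_mul, norm_mul, zpow_natCast, norm_pow, norm_neg, norm_one, one_pow, one_mul,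
      Real.norm_eq_abs, Real.norm_eq_abs, abs_of_pos (Real.exp_pos _), abs_of_pos (by positivity)]
    have e : Real.exp (-π * ((((n+1:ℕ):ℤ) : ℝ) + 1 / 2) ^ 2) ≤ r * Real.exp (-π / 4) * r ^ n := by
      rw [hr, ← Real.exp_nat_mul, ← Real.exp_add, ← Real.exp_add]
      apply Real.exp_le_exp.2
      push_cast
      have : 0 ≤ π * ((n:ℝ) ^ 2 + n) := by have := Real.pi_pos; positivity
      nlinarith
    calc _ ≤ (3 / 2 * 3 ^ n) * (r * Real.exp (-π / 4) * r ^ n) := by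
          gcongr
          push_cast
          exact aux_3 n
      _ = _ := by rw [mul_pow]; ring
  have hg := (hasSum_geometric_of_lt_one (r := 3 * r) (by positivity) (by linarith)).mul_left
    (3 / 2 * r * Real.exp (-π / 4))
  have hs1 : Summable (fun n : ℕ => f ((n + 1 : ℕ) : ℤ)) := hg.summable.of_norm_bounded hb
  have hs : Summable (fun n : ℕ => f n) := (summable_nat_add_iff (f := fun n : ℕ => f n) 1).1 hs1
  have ht := tsum_of_norm_bounded hg hb
  have hden : janssenDen = 2 * ∑' n : ℕ, f n := by
    have := tsum_of_nat_of_neg_add_one (f := f) hs (by simpa only [hsymm] using hs)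
    simp only [hsymm] at this
    rw [janssenDen, this]; ring
  have h0 : f ((0:ℕ):ℤ) = 1 / 2 * Real.exp (-π / 4) := by
    simp only [hf]; norm_num; ring
  rw [hden, hs.tsum_eq_zero_add, h0]
  rw [Real.norm_eq_abs] at ht
  have ht := (abs_le.1 ht).1
  have h5 : 3 / 2 * r * (1 - 3 * r)⁻¹ ≤ 0.003 := by
    rw [← div_eq_mul_inv, div_le_iff₀ (by linarith)]; linarith
  have h6 := Real.exp_pos (-π / 4)
  nlinarith

lemma aux_coeff (k : ℤ) : |janssenCoeff k| ≤ 1.01 * Real.exp (-π * |(k:ℝ)|) := by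
  have hd := aux_den
  have h6 := Real.exp_pos (-π / 4)
  have hdpos : 0 < janssenDen := by nlinarith
  have hr0 := Real.exp_pos (-π * 2)
  have hr1 := aux_r
  have hg := (hasSum_geometric_of_lt_one hr0.le (by linarith)).mul_left
    (Real.exp (-π / 4) * Real.exp (-π * |(k:ℝ)|))
  rw [janssenCoeff, abs_div, abs_of_pos hdpos, div_le_iff₀ hdpos, ← Real.norm_eq_abs]
  refine (tsum_of_norm_bounded hg (fun m => ?_)).trans ?_
  · rw [norm_mul, norm_mul, norm_zpow, norm_pow, norm_neg, norm_one, one_pow, one_zpow, one_mul,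
      one_mul, Real.norm_eq_abs, abs_of_pos (Real.exp_pos _), ← Real.exp_nat_mul, ← Real.exp_add,
      ← Real.exp_add]
    apply Real.exp_le_exp.2
    have h1 : 0 ≤ π * (2 * (m:ℝ) * |(k:ℝ)|) := by have := Real.pi_pos; positivity
    have h2 : (0:ℝ) ≤ (m:ℝ) * (m - 1) := by
      rcases m with _ | m
      · simp
      · push_cast; ring_nf; positivity
    have h3 := mul_nonneg Real.pi_pos.le h2
    nlinarith
  · have h5 : (1 - Real.exp (-π * 2))⁻¹ ≤ 1.003 := by
      rw [inv_le_comm₀ (by linarith) (by norm_num)]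
      have : (1.003 : ℝ)⁻¹ ≤ 0.998 := by norm_num
      linarith
    have h7 := Real.exp_pos (-π * |(k:ℝ)|)
    calc _ ≤ Real.exp (-π / 4) * Real.exp (-π * |(k:ℝ)|) * 1.003 := by gcongr
      _ ≤ 1.01 * Real.exp (-π * |(k:ℝ)|) * (0.994 * Real.exp (-π / 4)) := by nlinarith [mul_pos h6 h7]
      _ ≤ _ := by gcongr

open HurwitzZeta in
lemma aux_expo (t : ℝ) : ∃ a : ℝ, ∀ k : ℤ,
    -π * |(k:ℝ)| + -π * (t - Real.sqrt 2 * (k : ℝ)) ^ 2 ≤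
      -π * |t| / Real.sqrt 2 + π / 8 + -π * (k + a) ^ 2 * 2 := by
  obtain ⟨s, rfl⟩ : ∃ s, t = Real.sqrt 2 * s := ⟨t / Real.sqrt 2, by field_simp⟩
  have h2 : Real.sqrt 2 ^ 2 = 2 := Real.sq_sqrt (by norm_num)
  have h3 : (0:ℝ) < Real.sqrt 2 := by positivity
  have e1 : -π * |Real.sqrt 2 * s| / Real.sqrt 2 = -π * |s| := by
    rw [abs_mul, abs_of_pos h3]; field_simp
  have e2 : ∀ k : ℝ, (Real.sqrt 2 * s - Real.sqrt 2 * k) ^ 2 = 2 * (s - k) ^ 2 := by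
    intro k; rw [← mul_sub, mul_pow, h2]
  simp only [e1, e2]
  have hp := Real.pi_pos
  rcases le_total 0 s with hs | hs
  · refine ⟨-s + 1 / 4, fun k => ?_⟩
    rw [abs_of_nonneg hs]
    nlinarith [mul_le_mul_of_nonneg_left (le_abs_self (k:ℝ)) hp.le]
  · refine ⟨-s - 1 / 4, fun k => ?_⟩
    rw [abs_of_nonpos hs]
    nlinarith [mul_le_mul_of_nonneg_left (neg_le_abs (k:ℝ)) hp.le]

/-- Pointwise bound for the canonical dual window of the Gaussian Gabor frame
on the lattice `(1/√2)ℤ²`: `|ψ(t)| ≤ e^{-π|t|/√2}` for all `t ∈ ℝ`. -/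
theorem dualWindow_pointwise_bound (t : ℝ) :
    |dualWindow t| ≤ Real.exp (-π * |t| / Real.sqrt 2) := by
  obtain ⟨a, ha⟩ := aux_expo t
  set E := Real.exp (-π * |t| / Real.sqrt 2) with hE
  have hE0 : 0 < E := Real.exp_pos _
  have hg := (HurwitzZeta.hasSum_int_evenKernel a (by norm_num : (0:ℝ) < 2)).mul_left
    (1.01 * 2 ^ ((1 : ℝ) / 4) * (E * Real.exp (π / 8)))
  have hsum := tsum_of_norm_bounded (f := fun k : ℤ => janssenCoeff k *
      (2 ^ ((1 : ℝ) / 4) * Real.exp (-π * (t - Real.sqrt 2 * (k : ℝ)) ^ 2))) hg (fun k => by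
    rw [norm_mul, Real.norm_eq_abs, Real.norm_eq_abs,
      abs_of_pos (a := 2 ^ ((1 : ℝ) / 4) * Real.exp (-π * (t - Real.sqrt 2 * (k : ℝ)) ^ 2))
      (by positivity)]
    have h := Real.exp_le_exp.2 (ha k)
    rw [Real.exp_add, Real.exp_add, Real.exp_add, ← hE] at h
    calc _ ≤ 1.01 * Real.exp (-π * |(k:ℝ)|) * (2 ^ ((1 : ℝ) / 4) *
            Real.exp (-π * (t - Real.sqrt 2 * (k : ℝ)) ^ 2)) := by
          gcongr; exact aux_coeff k
      _ = 1.01 * 2 ^ ((1 : ℝ) / 4) * (Real.exp (-π * |(k:ℝ)|) *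
            Real.exp (-π * (t - Real.sqrt 2 * (k : ℝ)) ^ 2)) := by ring
      _ ≤ 1.01 * 2 ^ ((1 : ℝ) / 4) * (E * Real.exp (π / 8) * Real.exp (-π * (k + a) ^ 2 * 2)) := by
          gcongr
      _ = _ := by ring)
  rw [Real.norm_eq_abs] at hsum
  have hth := aux_theta_low (Real.sqrt 2 * π * t)
  have hK : HurwitzZeta.evenKernel a 2 ≤ 1.004 := by
    have hr1 := aux_r
    have : 2 * Real.exp (-π * 2) / (1 - Real.exp (-π * 2)) ≤ 0.004 := by
      rw [div_le_iff₀ (by linarith)]; linarith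
    linarith [aux_even a]
  have hb : |∑' k : ℤ, janssenCoeff k *
      (2 ^ ((1 : ℝ) / 4) * Real.exp (-π * (t - Real.sqrt 2 * (k : ℝ)) ^ 2))| ≤ 1.81 * E := by
    refine hsum.trans ?_
    calc _ ≤ 1.01 * 1.19 * (E * 1.484) * 1.004 := by
          gcongr
          · exact (HurwitzZeta.hasSum_int_evenKernel a (by norm_num : (0:ℝ) < 2)).nonneg (fun n => (Real.exp_pos _).le)
          · exact aux_2
          · exact aux_e8
      _ ≤ _ := by nlinarith
  rw [dualWindow, abs_mul, abs_of_pos (by positivity), one_div, inv_mul_le_iff₀ (by positivity)]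
  nlinarith
end
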